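/- Let T be a search tree on a finite undirected tree 𝒯 and let ℋ be a connected subgraph of 𝒯. Then LCA_T(ℋ), the deepest vertex of T that is an ancestor in T of every vertex of ℋ, belongs to V(ℋ). -/

import Mathlib

open Filter Topology

universe u

variable {V : Type u}

/-- Rooted trees with vertices labelled by elements of `V`. -/
inductive RTree (V : Type u) : Type u where
  | node : V → List (RTree V) → RTree V

namespace RTree

/-- The root of a rooted tree. -/
def root : RTree V → V
  | node r _ => r

/-- The subtrees rooted at the children of the root. -/
def children : RTree V → List (RTree V)
  | node _ ts => ts

/-- The list of pairs `(v, path from the root to v)` over all vertices `v` of the tree. -/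
def pathsFrom : RTree V → List (V × List V)
  | node r ts =>
      (r, [r]) ::
        (ts.attach.map fun t => (t.1.pathsFrom.map fun p => (p.1, r :: p.2))).flatten
  decreasing_by
    simp only [RTree.node.sizeOf_spec]
    have := List.sizeOf_lt_of_mem t.2
    omega

/-- The vertex set of a rooted tree. -/
def vertSet (T : RTree V) : Set V := {v | ∃ p ∈ T.pathsFrom, p.1 = v}

/-- `Path_T(v)`: the set of vertices on the path in `T` from the root to `v`
(including both endpoints). -/
def pathSet (T : RTree V) (v : V) : Set V := {x | ∃ p ∈ T.pathsFrom, p.1 = v ∧ x ∈ p.2}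

/-- The depth of a vertex `v` in `T`; the root has depth 1. -/
noncomputable def depth (T : RTree V) (v : V) : ℕ := (T.pathSet v).ncard

/-- All subtrees of a rooted tree (including the tree itself). -/
def allSubtrees : RTree V → List (RTree V)
  | node r ts => node r ts :: (ts.attach.map fun t => t.1.allSubtrees).flatten
  decreasing_by
    simp only [RTree.node.sizeOf_spec]
    have := List.sizeOf_lt_of_mem t.2
    omega

/-- Two rooted trees are equivalent (represent the same search tree) if they have
the same root-to-vertex paths. -/
def Equiv (T₁ T₂ : RTree V) : Prop := ∀ v, T₁.pathSet v = T₂.pathSet v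

end RTree

/-- `x` and `y` are joined by a walk of `G` staying inside `s`. -/
def ReachIn (G : SimpleGraph V) (s : Set V) (x y : V) : Prop :=
  ∃ p : G.Walk x y, ∀ v ∈ p.support, v ∈ s

/-- The connected component of `x` in the subgraph of `G` induced by `s`. -/
def compIn (G : SimpleGraph V) (s : Set V) (x : V) : Set V := {y | ReachIn G s x y}

/-- The set of connected components of the subgraph of `G` induced by `s`. -/
def comps (G : SimpleGraph V) (s : Set V) : Set (Set V) := {c | ∃ x ∈ s, c = compIn G s x}

/-- `s` induces a (nonempty) connected subgraph of `G`. -/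
def ConnIn (G : SimpleGraph V) (s : Set V) : Prop :=
  s.Nonempty ∧ ∀ x ∈ s, ∀ y ∈ s, ReachIn G s x y

/-- The total weight of a set of vertices. -/
noncomputable def wsum (w : V → ℝ) (s : Set V) : ℝ := ∑ᶠ x ∈ s, w x

/-- `IsSearchTree G s T`: `T` is a search tree on the subgraph of `G` induced by `s`.
Its root `r` is a vertex of `s`, its vertex set is `s`, and the subtrees rooted at the
children of `r` are search trees on the connected components of the induced subgraph
on `s \ {r}` (one subtree for each component). -/
inductive IsSearchTree (G : SimpleGraph V) : Set V → RTree V → Prop where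
  | node {s : Set V} {r : V} {ts : List (RTree V)} :
      r ∈ s →
      (RTree.node r ts).vertSet = s →
      (∀ t ∈ ts, IsSearchTree G (compIn G (s \ {r}) t.root) t) →
      ts.Pairwise (fun t₁ t₂ => compIn G (s \ {r}) t₁.root ≠ compIn G (s \ {r}) t₂.root) →
      IsSearchTree G s (RTree.node r ts)

/-- The cost of a search tree: `∑_x w(x) · depth(x)`, the root having depth 1. -/
noncomputable def cost (w : V → ℝ) (T : RTree V) : ℝ :=
  ∑ᶠ v ∈ T.vertSet, w v * (T.depth v : ℝ)

/-- The optimum cost of a search tree on the subgraph of `G` induced by `s`. -/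
noncomputable def OPT (G : SimpleGraph V) (w : V → ℝ) (s : Set V) : ℝ :=
  sInf (cost w '' {T | IsSearchTree G s T})

/-- `v` is an `α`-centroid of the subgraph of `G` induced by `s` (with weights `w`):
every connected component of the induced subgraph on `s \ {v}` has weight at most
`α` times the weight of `s`. -/
def IsAlphaCentroid (G : SimpleGraph V) (w : V → ℝ) (α : ℝ) (s : Set V) (v : V) : Prop :=
  v ∈ s ∧ ∀ x ∈ s \ {v}, wsum w (compIn G (s \ {v}) x) ≤ α * wsum w s

/-- `v` is a centroid of the subgraph of `G` induced by `s` (with weights `w`). -/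
def IsCentroid (G : SimpleGraph V) (w : V → ℝ) (s : Set V) (v : V) : Prop :=
  v ∈ s ∧ ∀ x ∈ s \ {v}, wsum w (compIn G (s \ {v}) x) ≤ wsum w s / 2

/-- `T` is an `α`-centroid tree on the subgraph of `G` induced by `s`. -/
def IsAlphaCentroidTree (G : SimpleGraph V) (w : V → ℝ) (α : ℝ) (s : Set V) (T : RTree V) :
    Prop :=
  IsSearchTree G s T ∧ ∀ t ∈ T.allSubtrees, IsAlphaCentroid G w α t.vertSet t.root

/-- `T` is a centroid tree on the subgraph of `G` induced by `s`. -/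
def IsCentroidTree (G : SimpleGraph V) (w : V → ℝ) (s : Set V) (T : RTree V) : Prop :=
  IsSearchTree G s T ∧ ∀ t ∈ T.allSubtrees, IsCentroid G w t.vertSet t.root

/-- `cent(𝒯,w)`: the maximum cost of a centroid tree. -/
noncomputable def centCost (G : SimpleGraph V) (w : V → ℝ) (s : Set V) : ℝ :=
  sSup (cost w '' {T | IsCentroidTree G w s T})

/-- `centᵅ(𝒯,w)`: the maximum cost of an `α`-centroid tree (`0` if none exists, since
`sSup ∅ = 0` in `ℝ`). -/
noncomputable def centCostA (G : SimpleGraph V) (w : V → ℝ) (α : ℝ) (s : Set V) : ℝ :=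
  sSup (cost w '' {T | IsAlphaCentroidTree G w α s T})

/-- `b` is a child of `a` in the rooted tree `T`. -/
def ChildRel (T : RTree V) (a b : V) : Prop :=
  ∃ t ∈ T.allSubtrees, t.root = a ∧ ∃ t' ∈ t.children, t'.root = b

namespace RTree

theorem mem_pathsFrom_node {r : V} {ts : List (RTree V)} {p : V × List V} :
    p ∈ (node r ts).pathsFrom ↔
      p = (r, [r]) ∨ ∃ t ∈ ts, ∃ q ∈ t.pathsFrom, (q.1, r :: q.2) = p := by
  rw [pathsFrom]
  simp

theorem mem_vertSet_node {r v : V} {ts : List (RTree V)} :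
    v ∈ (node r ts).vertSet ↔ v = r ∨ ∃ t ∈ ts, v ∈ t.vertSet := by
  simp only [vertSet, Set.mem_ofPred_eq, mem_pathsFrom_node]
  constructor
  · rintro ⟨p, rfl | ⟨t, ht, q, hq, rfl⟩, rfl⟩
    · exact Or.inl rfl
    · exact Or.inr ⟨t, ht, q, hq, rfl⟩
  · rintro (rfl | ⟨t, ht, q, hq, rfl⟩)
    · exact ⟨_, Or.inl rfl, rfl⟩
    · exact ⟨_, Or.inr ⟨t, ht, q, hq, rfl⟩, rfl⟩

theorem mem_pathSet_node {r v x : V} {ts : List (RTree V)} :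
    x ∈ (node r ts).pathSet v ↔
      (v = r ∧ x = r) ∨ ∃ t ∈ ts, v ∈ t.vertSet ∧ (x = r ∨ x ∈ t.pathSet v) := by
  simp only [pathSet, vertSet, Set.mem_ofPred_eq, mem_pathsFrom_node]
  constructor
  · rintro ⟨p, rfl | ⟨t, ht, q, hq, rfl⟩, rfl, hx⟩
    · exact Or.inl ⟨rfl, by simpa using hx⟩
    · exact Or.inr ⟨t, ht, ⟨q, hq, rfl⟩,
        (List.mem_cons.1 hx).imp_right fun h => ⟨q, hq, rfl, h⟩⟩
  · rintro (⟨rfl, rfl⟩ | ⟨t, ht, ⟨q, hq, rfl⟩, rfl | ⟨q', hq', h, hx⟩⟩)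
    · exact ⟨_, Or.inl rfl, rfl, by simp⟩
    · exact ⟨_, Or.inr ⟨t, ht, q, hq, rfl⟩, rfl, by simp⟩
    · exact ⟨_, Or.inr ⟨t, ht, q', hq', rfl⟩, h, by simp [hx]⟩

theorem root_mem_vertSet (T : RTree V) : T.root ∈ T.vertSet := by
  cases T
  exact mem_vertSet_node.2 (Or.inl rfl)

theorem root_mem_pathSet {T : RTree V} {v : V} (hv : v ∈ T.vertSet) :
    T.root ∈ T.pathSet v := by
  cases T
  refine mem_pathSet_node.2 ((mem_vertSet_node.1 hv).imp (fun h => ⟨h, rfl⟩) ?_)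
  rintro ⟨t, ht, h⟩
  exact ⟨t, ht, h, Or.inl rfl⟩

end RTree

theorem ReachIn.symm {G : SimpleGraph V} {s : Set V} {x y : V} (h : ReachIn G s x y) :
    ReachIn G s y x := by
  obtain ⟨p, hp⟩ := h
  exact ⟨p.reverse, fun v hv => hp v (by simpa using hv)⟩

theorem ReachIn.trans {G : SimpleGraph V} {s : Set V} {x y z : V} (h : ReachIn G s x y)
    (h' : ReachIn G s y z) : ReachIn G s x z := by
  obtain ⟨p, hp⟩ := h
  obtain ⟨q, hq⟩ := h'
  refine ⟨p.append q, fun v hv => ?_⟩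
  exact ((SimpleGraph.Walk.mem_support_append_iff p q).1 hv).elim (hp v) (hq v)

theorem ReachIn.mono {G : SimpleGraph V} {s s' : Set V} {x y : V} (h : ReachIn G s x y)
    (hs : s ⊆ s') : ReachIn G s' x y := by
  obtain ⟨p, hp⟩ := h
  exact ⟨p, fun v hv => hs (hp v hv)⟩

theorem ReachIn.right_mem {G : SimpleGraph V} {s : Set V} {x y : V} (h : ReachIn G s x y) :
    y ∈ s := by
  obtain ⟨p, hp⟩ := h
  exact hp y p.end_mem_support

theorem compIn_eq_of_mem {G : SimpleGraph V} {s : Set V} {x y v : V}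
    (hx : v ∈ compIn G s x) (hy : v ∈ compIn G s y) : compIn G s x = compIn G s y := by
  have h : ReachIn G s x y := ReachIn.trans hx (ReachIn.symm hy)
  ext z
  exact ⟨fun hz => h.symm.trans hz, fun hz => h.trans hz⟩

namespace IsSearchTree

variable {G : SimpleGraph V} {S : Set V} {T : RTree V}

theorem vertSet_eq (h : IsSearchTree G S T) : T.vertSet = S := by
  cases h
  assumption

theorem pathSet_subset (h : IsSearchTree G S T) (v : V) : T.pathSet v ⊆ S := by
  rw [← h.vertSet_eq]
  induction h generalizing v with
  | node hr hS hts hp ih =>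
    intro x hx
    rw [RTree.mem_vertSet_node]
    rcases RTree.mem_pathSet_node.1 hx with ⟨-, h⟩ | ⟨t, ht, -, h | h⟩
    · exact Or.inl h
    · exact Or.inl h
    · exact Or.inr ⟨t, ht, ih t ht v h⟩

theorem node_pathSet_root {r : V} {ts : List (RTree V)}
    (h : IsSearchTree G S (RTree.node r ts)) : (RTree.node r ts).pathSet r = {r} := by
  cases h with
  | node _ _ hts _ =>
    ext x
    rw [RTree.mem_pathSet_node, Set.mem_singleton_iff]
    constructor
    · rintro (⟨-, hx⟩ | ⟨t, ht, hrt, -⟩)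
      · exact hx
      · rw [(hts t ht).vertSet_eq] at hrt
        exact absurd rfl hrt.right_mem.2
    · exact fun hx => Or.inl ⟨rfl, hx⟩

theorem node_pathSet_child {r v : V} {ts : List (RTree V)}
    (h : IsSearchTree G S (RTree.node r ts)) {t : RTree V} (ht : t ∈ ts)
    (hv : v ∈ t.vertSet) : (RTree.node r ts).pathSet v = insert r (t.pathSet v) := by
  cases h with
  | node _ _ hts hpw =>
    have hvc := hv
    rw [(hts t ht).vertSet_eq] at hvc
    ext x
    rw [RTree.mem_pathSet_node, Set.mem_insert_iff]
    constructor
    · rintro (⟨hvr, -⟩ | ⟨t', ht', hv', hx⟩)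
      · exact absurd hvr hvc.right_mem.2
      · rw [(hts t' ht').vertSet_eq] at hv'
        have htt : t' = t := by
          by_contra hne
          have : Std.Symm fun t₁ t₂ : RTree V =>
              compIn G (S \ {r}) t₁.root ≠ compIn G (S \ {r}) t₂.root := ⟨fun _ _ => Ne.symm⟩
          exact hpw.forall ht' ht hne (compIn_eq_of_mem hv' hvc)
        exact htt ▸ hx
    · exact fun hx => Or.inr ⟨t, ht, hv, hx⟩

theorem node_depth_child [Finite V] {r v : V} {ts : List (RTree V)}
    (h : IsSearchTree G S (RTree.node r ts)) {t : RTree V} (ht : t ∈ ts)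
    (hv : v ∈ t.vertSet) : (RTree.node r ts).depth v = t.depth v + 1 := by
  rw [RTree.depth, h.node_pathSet_child ht hv, RTree.depth]
  refine Set.ncard_insert_of_notMem (fun hr => ?_)
  cases h with
  | node _ _ hts _ => exact absurd rfl ((hts t ht).pathSet_subset v hr).right_mem.2

theorem lca_mem [Finite V] (hT : IsSearchTree G S T) {s : Set V} (hsS : s ⊆ S)
    (hs : ConnIn G s) {l : V} (hanc : ∀ v ∈ s, l ∈ T.pathSet v)
    (hdeep : ∀ u : V, (∀ v ∈ s, u ∈ T.pathSet v) → T.depth u ≤ T.depth l) : l ∈ s := by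
  induction hT with
  | @node S r ts hr hS hts hpw ih =>
    have hT : IsSearchTree G S (RTree.node r ts) := .node hr hS hts hpw
    by_cases hrs : r ∈ s
    · have hl := hanc r hrs
      rw [hT.node_pathSet_root, Set.mem_singleton_iff] at hl
      exact hl ▸ hrs
    obtain ⟨⟨x, hx⟩, hconn⟩ := id hs
    have hsub : s ⊆ S \ {r} := fun v hv => ⟨hsS hv, fun h => hrs (h ▸ hv)⟩
    obtain ⟨t, ht, hxt⟩ : ∃ t ∈ ts, x ∈ t.vertSet := by
      have hxT := hsS hx
      rw [← hS, RTree.mem_vertSet_node] at hxT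
      exact hxT.resolve_left (hsub hx).2
    have hst : s ⊆ compIn G (S \ {r}) t.root := by
      intro v hv
      rw [(hts t ht).vertSet_eq] at hxt
      exact ReachIn.trans hxt ((hconn x hx v hv).mono hsub)
    have hpath : ∀ v ∈ s, (RTree.node r ts).pathSet v = insert r (t.pathSet v) := fun v hv =>
      hT.node_pathSet_child ht ((hts t ht).vertSet_eq ▸ hst hv)
    have hlift : ∀ u, (∀ v ∈ s, u ∈ t.pathSet v) →
        (∀ v ∈ s, u ∈ (RTree.node r ts).pathSet v) := fun u hu v hv => by
      rw [hpath v hv]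
      exact Or.inr (hu v hv)
    have hlr : l ≠ r := by
      rintro rfl
      have hroot : ∀ v ∈ s, t.root ∈ t.pathSet v := fun v hv =>
        RTree.root_mem_pathSet ((hts t ht).vertSet_eq ▸ hst hv)
      have hle := hdeep t.root (hlift _ hroot)
      have hpos : 0 < t.depth t.root :=
        (Set.ncard_pos).2 ⟨_, RTree.root_mem_pathSet t.root_mem_vertSet⟩
      have hone : (RTree.node l ts).depth l = 1 := by
        rw [RTree.depth, hT.node_pathSet_root, Set.ncard_singleton]
      rw [hT.node_depth_child ht t.root_mem_vertSet, hone] at hle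
      omega
    have hanc' : ∀ v ∈ s, l ∈ t.pathSet v := fun v hv => by
      have hl := hanc v hv
      rw [hpath v hv] at hl
      exact hl.resolve_left hlr
    have hvert : ∀ u, (∀ v ∈ s, u ∈ t.pathSet v) → u ∈ t.vertSet := fun u hu =>
      (hts t ht).vertSet_eq ▸ (hts t ht).pathSet_subset x (hu x hx)
    refine ih t ht hst hanc' fun u hu => ?_
    have hle := hdeep u (hlift u hu)
    rw [hT.node_depth_child ht (hvert u hu), hT.node_depth_child ht (hvert l hanc')] at hle
    omega

end IsSearchTree

theorem lca_mem_of_connected {V : Type} [Fintype V]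
    (G : SimpleGraph V) (hG : G.IsTree)
    (T : RTree V) (hT : IsSearchTree G Set.univ T)
    (s : Set V) (hs : ConnIn G s)
    (l : V) (hanc : ∀ v ∈ s, l ∈ T.pathSet v)
    (hdeep : ∀ u : V, (∀ v ∈ s, u ∈ T.pathSet v) → T.depth u ≤ T.depth l) :
    l ∈ s := by
  exact hT.lca_mem (Set.subset_univ s) hs hanc hdeep
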